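/- Let G be an undirected graph on n agents (n ≥ 2) and consider an instance of Gossip-neg-change on G with m goals, each goal fluent having length at most d+1, where plans are finite sequences mixing calls along edges of G and CHANGE actions. If some plan satisfies all the goals, then there is a plan of length at most n + m·d·(n−1) that satisfies all the goals. -/

import Mathlib

/-- A fluent is a nonempty list of agents `(i_1, ..., i_r, j)` representing
`K_{i_1} ... K_{i_r} s_j`.  In the initial state a fluent is true iff `r = 0` or `i_r = j`. -/
def initState (n : ℕ) : Set (List (Fin n)) :=
  {l | (∃ j, l = [j]) ∨ ∃ p j, l = p ++ [j, j]}

/-- A two-way call between agents `i` and `j`. -/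
def callStep {n : ℕ} (i j : Fin n) (S : Set (List (Fin n))) : Set (List (Fin n)) :=
  S ∪ {l | ∃ w f : List (Fin n), l = w ++ f ∧ w ≠ [] ∧ (∀ a ∈ w, a = i ∨ a = j) ∧
        f ≠ [] ∧ (i :: f ∈ S ∨ j :: f ∈ S)}

/-- The state resulting from applying a sequence of two-way calls to the initial state. -/
def runCalls (n : ℕ) (calls : List (Fin n × Fin n)) : Set (List (Fin n)) :=
  calls.foldl (fun S c => callStep c.1 c.2 S) (initState n)

/-- The action `CHANGE_i`: every fluent `K_{i_1} ... K_{i_r} s_i` with `i_r ≠ i` becomes false. -/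
def changeStep {n : ℕ} (i : Fin n) (S : Set (List (Fin n))) : Set (List (Fin n)) :=
  S \ {l | ∃ p k, l = p ++ [k, i] ∧ k ≠ i}

/-- An action is either a two-way call (`Sum.inl`) or a `CHANGE` action (`Sum.inr`). -/
def applyAct {n : ℕ} (S : Set (List (Fin n))) (a : (Fin n × Fin n) ⊕ Fin n) :
    Set (List (Fin n)) :=
  match a with
  | Sum.inl c => callStep c.1 c.2 S
  | Sum.inr i => changeStep i S

/-- The state resulting from applying a plan (a sequence of calls and CHANGE actions). -/
def runPlan (n : ℕ) (plan : List ((Fin n × Fin n) ⊕ Fin n)) : Set (List (Fin n)) :=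
  plan.foldl applyAct (initState n)

/-- Closure properties shared by all states reachable from the initial state by calls:
initial facts persist, knowledge is truthful, and agents are positively introspective. -/
structure EpistemicallyClosed {n : ℕ} (S : Set (List (Fin n))) : Prop where
  init_subset : initState n ⊆ S
  truthful : ∀ a f, f ≠ [] → a :: f ∈ S → f ∈ S
  introspective : ∀ b g, b :: g ∈ S → b :: b :: g ∈ S

theorem epistemicallyClosed_initState (n : ℕ) : EpistemicallyClosed (initState n) where
  init_subset := subset_rfl
  truthful := by
    rintro a f hf (⟨j, h⟩ | ⟨p, j, h⟩)
    · simp_all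
    · rcases p with _ | ⟨q, p⟩
      · exact Or.inl ⟨j, by simp_all⟩
      · exact Or.inr ⟨p, j, by simp_all⟩
  introspective := by
    rintro b g (⟨j, h⟩ | ⟨p, j, h⟩)
    · exact Or.inr ⟨[], j, by simp_all⟩
    · exact Or.inr ⟨b :: p, j, by simp_all⟩

theorem EpistemicallyClosed.callStep {n : ℕ} {S : Set (List (Fin n))}
    (hS : EpistemicallyClosed S) (x y : Fin n) : EpistemicallyClosed (callStep x y S) where
  init_subset := hS.init_subset.trans Set.subset_union_left
  truthful := by
    rintro a f hf (h | ⟨w, g, h, hw, hwxy, hg, hk⟩)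
    · exact Or.inl (hS.truthful a f hf h)
    · rcases w with _ | ⟨b, w⟩
      · exact absurd rfl hw
      · obtain ⟨rfl, rfl⟩ : a = b ∧ f = w ++ g := by simpa using h
        rcases eq_or_ne w [] with rfl | hw'
        · exact Or.inl (hk.elim (hS.truthful _ _ hg) (hS.truthful _ _ hg))
        · exact Or.inr ⟨w, g, rfl, hw', fun c hc => hwxy c (List.mem_cons_of_mem _ hc), hg, hk⟩
  introspective := by
    rintro b g (h | ⟨w, f, h, hw, hwxy, hf, hk⟩)
    · exact Or.inl (hS.introspective b g h)
    · rcases w with _ | ⟨c, w⟩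
      · exact absurd rfl hw
      · obtain ⟨rfl, rfl⟩ : b = c ∧ g = w ++ f := by simpa using h
        exact Or.inr ⟨b :: b :: w, f, rfl, by simp, by simpa using hwxy, hf, hk⟩

theorem runCalls_concat {n : ℕ} (c : List (Fin n × Fin n)) (e : Fin n × Fin n) :
    runCalls n (c ++ [e]) = callStep e.1 e.2 (runCalls n c) := by
  simp [runCalls]

theorem epistemicallyClosed_runCalls {n : ℕ} (c : List (Fin n × Fin n)) :
    EpistemicallyClosed (runCalls n c) := by
  induction c using List.reverseRecOn with
  | nil => exact epistemicallyClosed_initState n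
  | append_singleton c e ih => rw [runCalls_concat]; exact ih.callStep _ _

theorem callStep_mono {n : ℕ} (x y : Fin n) {S T : Set (List (Fin n))} (h : S ⊆ T) :
    callStep x y S ⊆ callStep x y T := by
  rintro l (hl | ⟨w, f, hl, hw, hwxy, hf, hk⟩)
  · exact Or.inl (h hl)
  · exact Or.inr ⟨w, f, hl, hw, hwxy, hf, hk.imp (fun t => h t) (fun t => h t)⟩

theorem sublist_concat_cases {α : Type*} {s c : List α} {e : α} (h : s.Sublist (c ++ [e])) :
    s.Sublist c ∨ ∃ t, t.Sublist c ∧ s = t ++ [e] := by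
  obtain ⟨s₁, s₂, rfl, h₁, h₂⟩ := List.sublist_append_iff.mp h
  rcases s₂ with _ | ⟨a, s₂⟩
  · exact Or.inl (by simpa using h₁)
  · obtain ⟨rfl, rfl⟩ : a = e ∧ s₂ = [] := by
      have := h₂.length_le
      have h₃ : s₂ = [] := List.eq_nil_of_length_eq_zero (by simpa using this)
      subst h₃
      simpa using h₂
    exact Or.inr ⟨s₁, h₁, rfl⟩

/-- Inserting calls into a call sequence can only make more fluents true. -/
theorem runCalls_mono {n : ℕ} {c' c : List (Fin n × Fin n)} (h : c'.Sublist c) :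
    runCalls n c' ⊆ runCalls n c := by
  induction c using List.reverseRecOn generalizing c' with
  | nil => rw [List.sublist_nil.mp h]
  | append_singleton c e ih =>
    rw [runCalls_concat]
    rcases sublist_concat_cases h with h | ⟨t, ht, rfl⟩
    · exact (ih h).trans Set.subset_union_left
    · rw [runCalls_concat]; exact callStep_mono _ _ (ih ht)

/-- Knowledge of an already true fluent spreads only along calls with an agent who knows it. -/
theorem EpistemicallyClosed.knows_of_callStep {n : ℕ} {S : Set (List (Fin n))}
    (hS : EpistemicallyClosed S) {x y a : Fin n} {f : List (Fin n)} (hf : f ∈ S)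
    (h : a :: f ∈ _root_.callStep x y S) :
    a :: f ∈ S ∨ ((a = x ∨ a = y) ∧ (x :: f ∈ S ∨ y :: f ∈ S)) := by
  rcases h with h | ⟨w, g, h, hw, hwxy, hg, hk⟩
  · exact Or.inl h
  · right
    rcases w with _ | ⟨c, w⟩
    · exact absurd rfl hw
    · obtain ⟨rfl, rfl⟩ : a = c ∧ f = w ++ g := by simpa using h
      refine ⟨hwxy a (by simp), ?_⟩
      rcases w with _ | ⟨b, w⟩
      · exact hk
      · have hb := hS.introspective b _ hf
        rcases hwxy b (by simp) with rfl | rfl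
        · exact Or.inl hb
        · exact Or.inr hb

theorem EpistemicallyClosed.participant_of_knows_new {n : ℕ} {S : Set (List (Fin n))}
    (hS : EpistemicallyClosed S) {x y a : Fin n} {f : List (Fin n)} (hne : f ≠ [])
    (hf : f ∉ S) (h : a :: f ∈ _root_.callStep x y S) : a = x ∨ a = y := by
  rcases h with h | ⟨w, g, h, hw, hwxy, -⟩
  · exact absurd (hS.truthful a f hne h) hf
  · rcases w with _ | ⟨c, w⟩
    · exact absurd rfl hw
    · obtain ⟨rfl, rfl⟩ : a = c ∧ f = w ++ g := by simpa using h
      exact hwxy a (by simp)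

theorem participant_knows_new {n : ℕ} {S : Set (List (Fin n))} {x y a : Fin n}
    {f : List (Fin n)} (hf : f ∉ S) (h : f ∈ callStep x y S) (ha : a = x ∨ a = y) :
    a :: f ∈ callStep x y S := by
  rcases h with h | ⟨w, g, rfl, hw, hwxy, hg, hk⟩
  · exact absurd h hf
  · refine Or.inr ⟨a :: w, g, rfl, by simp, ?_, hg, hk⟩
    simpa [ha] using hwxy

open Classical in
/-- The agents knowing the fluent `f` after a sequence of calls. -/
noncomputable def knowers {n : ℕ} (f : List (Fin n)) (c : List (Fin n × Fin n)) :
    Finset (Fin n) :=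
  Finset.univ.filter fun a => a :: f ∈ runCalls n c

theorem mem_knowers {n : ℕ} {f : List (Fin n)} {c : List (Fin n × Fin n)} {a : Fin n} :
    a ∈ knowers f c ↔ a :: f ∈ runCalls n c := by
  simp [knowers]

theorem knowers_card_pos {n : ℕ} {f : List (Fin n)} {c : List (Fin n × Fin n)} (hne : f ≠ [])
    (hf : f ∈ runCalls n c) : 0 < (knowers f c).card := by
  rcases f with _ | ⟨b, g⟩
  · exact absurd rfl hne
  · exact Finset.card_pos.mpr
      ⟨b, mem_knowers.mpr ((epistemicallyClosed_runCalls c).introspective b g hf)⟩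

/-- If the true fluent `f` itself can always be obtained with at most `B` calls, then everybody
who knows `f` can learn it using at most one further call per additional knower. -/
theorem exists_sublist_knowers {n : ℕ} {f : List (Fin n)} (hne : f ≠ []) (B : ℕ)
    (hB : ∀ c, f ∈ runCalls n c → ∃ c', c'.Sublist c ∧ c'.length ≤ B ∧ f ∈ runCalls n c')
    (c : List (Fin n × Fin n)) (hf : f ∈ runCalls n c) :
    ∃ c', c'.Sublist c ∧ c'.length + 1 ≤ B + (knowers f c).card ∧
      knowers f c ⊆ knowers f c' := by
  induction c using List.reverseRecOn with
  | nil => exact ⟨[], .refl _, by have := knowers_card_pos hne hf; simp; omega, subset_rfl⟩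
  | append_singleton c e ih =>
    by_cases hfc : f ∈ runCalls n c
    · obtain ⟨c', hsub, hlen, hk⟩ := ih hfc
      have hgrow : knowers f c ⊆ knowers f (c ++ [e]) := fun a ha => by
        rw [mem_knowers] at ha ⊢
        exact runCalls_mono (List.sublist_append_left _ _) ha
      by_cases heq : knowers f (c ++ [e]) ⊆ knowers f c
      · refine ⟨c', hsub.trans (List.sublist_append_left _ _), ?_, heq.trans hk⟩
        have := Finset.card_le_card hgrow
        omega
      · refine ⟨c' ++ [e], hsub.append (.refl _), ?_, ?_⟩
        · have := Finset.card_lt_card (lt_of_le_not_ge hgrow heq)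
          simp
          omega
        · intro a ha
          rw [mem_knowers, runCalls_concat] at ha ⊢
          have hk' : ∀ b, b :: f ∈ runCalls n c → b :: f ∈ runCalls n c' := fun b hb =>
            mem_knowers.mp (hk (mem_knowers.mpr hb))
          rcases (epistemicallyClosed_runCalls c).knows_of_callStep hfc ha with h | ⟨h, h'⟩
          · exact Or.inl (hk' a h)
          · exact Or.inr ⟨[a], f, rfl, by simp, by simpa using h, hne,
              h'.imp (hk' _) (hk' _)⟩
    · obtain ⟨c', hsub, hlen, hfc'⟩ := hB _ hf
      refine ⟨c', hsub, by have := knowers_card_pos hne hf; omega, fun a ha => ?_⟩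
      rw [mem_knowers] at ha ⊢
      rcases sublist_concat_cases hsub with h | ⟨t, ht, rfl⟩
      · exact absurd (runCalls_mono h hfc') hfc
      · rw [runCalls_concat] at ha hfc' ⊢
        exact participant_knows_new (fun h => hfc (runCalls_mono ht h)) hfc'
          ((epistemicallyClosed_runCalls c).participant_of_knows_new hne hfc ha)

/-- A fluent of length `r + 1` made true by a sequence of calls is already made true by at most
`r * (n - 1)` of them. -/
theorem exists_short_sublist {n : ℕ} (f : List (Fin n)) (hne : f ≠ [])
    (c : List (Fin n × Fin n)) (hf : f ∈ runCalls n c) :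
    ∃ c', c'.Sublist c ∧ c'.length ≤ (f.length - 1) * (n - 1) ∧ f ∈ runCalls n c' := by
  induction f generalizing c with
  | nil => exact absurd rfl hne
  | cons a f ih =>
    rcases eq_or_ne f [] with rfl | hf'
    · exact ⟨[], List.nil_sublist _, by simp, Or.inl ⟨a, rfl⟩⟩
    · obtain ⟨c', hsub, hlen, hk⟩ := exists_sublist_knowers hf' _ (ih hf') c
        ((epistemicallyClosed_runCalls c).truthful a f hf' hf)
      refine ⟨c', hsub, ?_, mem_knowers.mp (hk (mem_knowers.mpr hf))⟩
      have hcard : (knowers f c).card ≤ n := by simpa using Finset.card_le_univ (knowers f c)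
      have hpos := List.length_pos_iff.mpr hf'
      obtain ⟨r, hr⟩ := Nat.exists_eq_add_of_le' hpos
      simp only [hr, List.length_cons, Nat.add_sub_cancel, Nat.add_mul] at hlen ⊢
      omega

/-- The calls of a plan made after the last `CHANGE_j`. -/
def callsSinceChange {n : ℕ} (j : Fin n) (plan : List ((Fin n × Fin n) ⊕ Fin n)) :
    List (Fin n × Fin n) :=
  plan.foldl (fun C a => Sum.elim (fun c => C ++ [c]) (fun k => if k = j then [] else C) a) []

theorem callsSinceChange_concat_call {n : ℕ} (j : Fin n)
    (plan : List ((Fin n × Fin n) ⊕ Fin n)) (c : Fin n × Fin n) :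
    callsSinceChange j (plan ++ [Sum.inl c]) = callsSinceChange j plan ++ [c] := by
  simp [callsSinceChange]

theorem callsSinceChange_concat_change {n : ℕ} (j k : Fin n)
    (plan : List ((Fin n × Fin n) ⊕ Fin n)) :
    callsSinceChange j (plan ++ [Sum.inr k]) = if k = j then [] else callsSinceChange j plan := by
  simp [callsSinceChange]

theorem runPlan_concat {n : ℕ} (plan : List ((Fin n × Fin n) ⊕ Fin n))
    (a : (Fin n × Fin n) ⊕ Fin n) :
    runPlan n (plan ++ [a]) = applyAct (runPlan n plan) a := by
  simp [runPlan]

/-- A call acts separately on the fluents about each secret. -/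
theorem mem_callStep_congr {n : ℕ} {S T : Set (List (Fin n))} {j : Fin n}
    (h : ∀ p, p ++ [j] ∈ S → p ++ [j] ∈ T) (x y : Fin n) (p : List (Fin n))
    (hp : p ++ [j] ∈ callStep x y S) : p ++ [j] ∈ callStep x y T := by
  rcases hp with hp | ⟨w, f, hl, hw, hwxy, hf, hk⟩
  · exact Or.inl (h p hp)
  · obtain ⟨g, k, rfl⟩ := List.eq_nil_or_concat' f |>.resolve_left hf
    obtain ⟨rfl, rfl⟩ : p = w ++ g ∧ j = k := by
      rw [← List.append_assoc] at hl
      simpa using List.append_inj' hl rfl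
    exact Or.inr ⟨w, g ++ [j], by simp, hw, hwxy, hf, hk.imp (h (x :: g)) (h (y :: g))⟩

/-- The truth of fluents about `s_j` depends only on the calls since the last `CHANGE_j`. -/
theorem mem_runPlan_iff {n : ℕ} (j : Fin n) (plan : List ((Fin n × Fin n) ⊕ Fin n))
    (p : List (Fin n)) :
    p ++ [j] ∈ runPlan n plan ↔ p ++ [j] ∈ runCalls n (callsSinceChange j plan) := by
  induction plan using List.reverseRecOn generalizing p with
  | nil => rfl
  | append_singleton plan a ih =>
    rw [runPlan_concat]
    rcases a with c | k
    · rw [callsSinceChange_concat_call, runCalls_concat]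
      exact ⟨mem_callStep_congr (fun p => (ih p).mp) _ _ p,
        mem_callStep_congr (fun p => (ih p).mpr) _ _ p⟩
    · rw [callsSinceChange_concat_change]
      split_ifs with hkj
      · subst hkj
        constructor
        · rintro ⟨-, h⟩
          rcases List.eq_nil_or_concat' p with rfl | ⟨q, b, rfl⟩
          · exact Or.inl ⟨k, rfl⟩
          · refine Or.inr ⟨q, k, ?_⟩
            by_cases hb : b = k
            · simp [hb]
            · exact absurd ⟨q, b, by simp, hb⟩ h
        · intro h
          refine ⟨(ih p).mpr ((epistemicallyClosed_runCalls _).init_subset h), ?_⟩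
          rintro ⟨q, b, hq, hb⟩
          rcases h with ⟨i, hi⟩ | ⟨r, i, hi⟩
          · have := congrArg List.length (hq.symm.trans hi)
            simp at this
          · have := List.append_inj' (hq.symm.trans hi) rfl
            simp only [List.cons.injEq, and_true] at this
            exact hb (this.2.1.trans this.2.2.symm)
      · refine Iff.trans ⟨fun h => h.1, fun h => ⟨h, ?_⟩⟩ (ih p)
        rintro ⟨q, b, hq, -⟩
        rw [show q ++ [b, k] = (q ++ [b]) ++ [k] by simp] at hq
        have := List.append_inj' hq rfl
        exact hkj (by simpa using this.2.symm)

/-- Given call sequences `s t` selected from the calls since the last `CHANGE_{key t}`, a plan can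
be thinned out to one `CHANGE` per agent in `J` and the selected calls. -/
theorem exists_short_subplan {n : ℕ} {ι : Type*} (key : ι → Fin n)
    (plan : List ((Fin n × Fin n) ⊕ Fin n)) (J : Finset (Fin n)) (T : Finset ι)
    (s : ι → List (Fin n × Fin n)) (hT : ∀ t ∈ T, key t ∈ J)
    (hs : ∀ t ∈ T, (s t).Sublist (callsSinceChange (key t) plan)) :
    ∃ plan', plan'.Sublist plan ∧ plan'.length ≤ J.card + ∑ t ∈ T, (s t).length ∧
      (∀ t ∈ T, (s t).Sublist (callsSinceChange (key t) plan')) ∧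
      ∀ j ∈ J, (callsSinceChange j plan').Sublist (callsSinceChange j plan) := by
  classical
  induction plan using List.reverseRecOn generalizing J T s with
  | nil => exact ⟨[], .refl _, by simp, hs, fun j _ => .refl _⟩
  | append_singleton plan a ih =>
    rcases a with c | k
    · simp only [callsSinceChange_concat_call] at hs ⊢
      by_cases hall : ∀ t ∈ T, (s t).Sublist (callsSinceChange (key t) plan)
      · obtain ⟨plan', h₁, h₂, h₃, h₄⟩ := ih J T s hT hall
        exact ⟨plan', h₁.trans (List.sublist_append_left _ _), h₂, h₃,
          fun j hj => (h₄ j hj).trans (List.sublist_append_left _ _)⟩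
      · push Not at hall
        obtain ⟨t₀, ht₀, hnot⟩ := hall
        have hex : ∀ t, ∃ u : List (Fin n × Fin n), t ∈ T →
            u.Sublist (callsSinceChange (key t) plan) ∧ (s t = u ∨ s t = u ++ [c]) := by
          intro t
          by_cases ht : t ∈ T
          · rcases sublist_concat_cases (hs t ht) with h | ⟨u, h, hu⟩
            · exact ⟨s t, fun _ => ⟨h, Or.inl rfl⟩⟩
            · exact ⟨u, fun _ => ⟨h, Or.inr hu⟩⟩
          · exact ⟨[], fun h => absurd h ht⟩
        choose u hu using hex
        obtain ⟨plan', h₁, h₂, h₃, h₄⟩ := ih J T u hT fun t ht => (hu t ht).1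
        have hlt : ∑ t ∈ T, (u t).length < ∑ t ∈ T, (s t).length := by
          refine Finset.sum_lt_sum (fun t ht => ?_) ⟨t₀, ht₀, ?_⟩
          · rcases (hu t ht).2 with h | h <;> simp [h]
          · rcases (hu t₀ ht₀).2 with h | h
            · exact absurd (h ▸ (hu t₀ ht₀).1) hnot
            · simp [h]
        refine ⟨plan' ++ [Sum.inl c], h₁.append (.refl _), by simp; omega, fun t ht => ?_,
          fun j hj => ?_⟩
        · rw [callsSinceChange_concat_call]
          rcases (hu t ht).2 with h | h
          · rw [h]; exact (h₃ t ht).trans (List.sublist_append_left _ _)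
          · rw [h]; exact (h₃ t ht).append (.refl _)
        · rw [callsSinceChange_concat_call]
          exact (h₄ j hj).append (.refl _)
    · simp only [callsSinceChange_concat_change] at hs ⊢
      by_cases hk : k ∈ J
      · obtain ⟨plan', h₁, h₂, h₃, h₄⟩ := ih (J.erase k) (T.filter fun t => k ≠ key t) s
          (fun t ht => by
            rw [Finset.mem_filter] at ht
            exact Finset.mem_erase.mpr ⟨ht.2.symm, hT t ht.1⟩)
          (fun t ht => by
            rw [Finset.mem_filter] at ht
            simpa [ht.2] using hs t ht.1)
        refine ⟨plan' ++ [Sum.inr k], h₁.append (.refl _), ?_, fun t ht => ?_, fun j hj => ?_⟩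
        · have := Finset.card_erase_add_one hk
          have : ∑ t ∈ T with k ≠ key t, (s t).length ≤ ∑ t ∈ T, (s t).length :=
            Finset.sum_le_sum_of_subset (Finset.filter_subset _ _)
          simp only [List.length_append, List.length_singleton]
          omega
        · have hst := hs t ht
          rw [callsSinceChange_concat_change]
          split_ifs at hst ⊢ with h
          · exact hst
          · exact h₃ t (Finset.mem_filter.mpr ⟨ht, h⟩)
        · rw [callsSinceChange_concat_change]
          split_ifs with h
          · exact .refl _
          · exact h₄ j (Finset.mem_erase.mpr ⟨fun h' => h h'.symm, hj⟩)
      · have hne : ∀ j ∈ J, k ≠ j := fun j hj h => hk (h ▸ hj)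
        obtain ⟨plan', h₁, h₂, h₃, h₄⟩ := ih J T s hT fun t ht => by
          simpa [hne _ (hT t ht)] using hs t ht
        exact ⟨plan', h₁.trans (List.sublist_append_left _ _), h₂, h₃, fun j hj => by
          simpa [hne j hj] using h₄ j hj⟩

theorem gossip_neg_change_short_plan (n : ℕ) (hn : 2 ≤ n) (G : SimpleGraph (Fin n))
    (d : ℕ) (Pos Neg : Finset (List (Fin n)))
    (hPos : ∀ l ∈ Pos, l ≠ [] ∧ l.length ≤ d + 1)
    (hNeg : ∀ l ∈ Neg, l ≠ [] ∧ l.length ≤ d + 1)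
    (hsol : ∃ plan : List ((Fin n × Fin n) ⊕ Fin n),
      (∀ c : Fin n × Fin n, Sum.inl c ∈ plan → G.Adj c.1 c.2) ∧
      (∀ l ∈ Pos, l ∈ runPlan n plan) ∧ ∀ l ∈ Neg, l ∉ runPlan n plan) :
    ∃ plan : List ((Fin n × Fin n) ⊕ Fin n),
      (∀ c : Fin n × Fin n, Sum.inl c ∈ plan → G.Adj c.1 c.2) ∧
      plan.length ≤ n + (Pos.card + Neg.card) * d * (n - 1) ∧
      (∀ l ∈ Pos, l ∈ runPlan n plan) ∧ ∀ l ∈ Neg, l ∉ runPlan n plan := by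
  classical
  obtain ⟨plan, hadj, hpos, hneg⟩ := hsol
  let key : List (Fin n) → Fin n := fun l => l.getLastD ⟨0, by omega⟩
  have hkey : ∀ l, l ≠ [] → ∃ p, l = p ++ [key l] := by
    intro l hl
    obtain ⟨p, j, rfl⟩ := (List.eq_nil_or_concat' l).resolve_left hl
    exact ⟨p, by simp [key]⟩
  have hex : ∀ l, ∃ s : List (Fin n × Fin n), l ∈ Pos →
      s.Sublist (callsSinceChange (key l) plan) ∧ s.length ≤ d * (n - 1) ∧
        l ∈ runCalls n s := by
    intro l
    by_cases hl : l ∈ Pos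
    · obtain ⟨hne, hlen⟩ := hPos l hl
      obtain ⟨p, hp⟩ := hkey l hne
      have hmem := hpos l hl
      rw [hp, mem_runPlan_iff, ← hp] at hmem
      obtain ⟨s, h₁, h₂, h₃⟩ := exists_short_sublist l hne _ hmem
      exact ⟨s, fun _ => ⟨h₁, h₂.trans (Nat.mul_le_mul_right _ (by omega)), h₃⟩⟩
    · exact ⟨[], fun h => absurd h hl⟩
  choose s hs using hex
  obtain ⟨plan', h₁, h₂, h₃, h₄⟩ := exists_short_subplan key plan Finset.univ Pos s
    (fun _ _ => Finset.mem_univ _) fun l hl => (hs l hl).1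
  refine ⟨plan', fun c hc => hadj c (h₁.subset hc), h₂.trans ?_, fun l hl => ?_,
    fun l hl hmem => hneg l hl ?_⟩
  · have hsum : ∑ l ∈ Pos, (s l).length ≤ Pos.card * (d * (n - 1)) := by
      simpa using Finset.sum_le_card_nsmul Pos _ _ fun l hl => (hs l hl).2.1
    rw [Finset.card_univ, Fintype.card_fin]
    calc n + ∑ l ∈ Pos, (s l).length ≤ n + Pos.card * (d * (n - 1)) := by omega
      _ ≤ n + (Pos.card + Neg.card) * (d * (n - 1)) := by gcongr; omega
      _ = n + (Pos.card + Neg.card) * d * (n - 1) := by rw [Nat.mul_assoc]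
  · obtain ⟨p, hp⟩ := hkey l (hPos l hl).1
    have hmem := runCalls_mono (h₃ l hl) (hs l hl).2.2
    rw [hp, mem_runPlan_iff, ← hp]
    exact hmem
  · obtain ⟨p, hp⟩ := hkey l (hNeg l hl).1
    rw [hp, mem_runPlan_iff, ← hp] at hmem ⊢
    exact runCalls_mono (h₄ _ (Finset.mem_univ _)) hmem
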